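/- arXiv:1506.03037 — 4 statements merged into one kernel-verified Lean document; each statement's English description precedes it below -/
import Mathlib

section
/- There exists a probability measure ν on the product σ-algebra of X = S^{ℤ₊} such that for every n ≥ 0 and every word α ∈ S^n one has ν([α]) = Tr(A(α)* E A(α)); moreover, ν is invariant under the left shift T. -/
open MeasureTheory Matrix
open scoped ComplexOrder

/-- The compound restriction map `A(α) = A_{α₁} ⋯ A_{α_n}` of a word `α ∈ S^n`. -/
noncomputable def wordMap {S : Type*} {d : Type*} [Fintype d] [DecidableEq d]
    (A : S → Matrix d d ℂ) {n : ℕ} (α : Fin n → S) : Matrix d d ℂ :=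
  (List.ofFn fun i => A (α i)).prod

/-- The cylinder set `[α] ⊆ S^{ℤ₊}` of a word `α ∈ S^n`. -/
def cylinder {S : Type*} {n : ℕ} (α : Fin n → S) : Set (ℕ → S) :=
  {x | ∀ i : Fin n, x (i : ℕ) = α i}

theorem isPiSystem_word_cylinders {S : Type*} :
    IsPiSystem {t : Set (ℕ → S) | ∃ (n : ℕ) (α : Fin n → S), t = _root_.cylinder α} := by
  rintro _ ⟨n, α, rfl⟩ _ ⟨m, β, rfl⟩ ⟨x, hxα, hxβ⟩
  refine ⟨max n m, fun i => x i, ?_⟩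
  ext y
  constructor
  · rintro ⟨hyα, hyβ⟩ ⟨i, hi⟩
    rcases lt_max_iff.1 hi with h | h
    · exact (hyα ⟨i, h⟩).trans (hxα ⟨i, h⟩).symm
    · exact (hyβ ⟨i, h⟩).trans (hxβ ⟨i, h⟩).symm
  · intro hy
    exact ⟨fun i => (hy ⟨i, i.2.trans_le (le_max_left n m)⟩).trans (hxα i),
      fun i => (hy ⟨i, i.2.trans_le (le_max_right n m)⟩).trans (hxβ i)⟩

theorem measurableSet_word_cylinder {S : Type*} [MeasurableSpace S] [DiscreteMeasurableSpace S]
    {n : ℕ} (α : Fin n → S) : MeasurableSet (_root_.cylinder α) := by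
  have h : _root_.cylinder α = ⋂ i : Fin n, (fun x : ℕ → S => x i) ⁻¹' {α i} := by
    ext x
    simp [_root_.cylinder]
  rw [h]
  exact MeasurableSet.iInter fun i => measurable_pi_apply _ (MeasurableSet.of_discrete)

theorem generateFrom_word_cylinders {S : Type*} [Finite S] [MeasurableSpace S]
    [DiscreteMeasurableSpace S] :
    (MeasurableSpace.pi : MeasurableSpace (ℕ → S)) = MeasurableSpace.generateFrom
      {t : Set (ℕ → S) | ∃ (n : ℕ) (α : Fin n → S), t = _root_.cylinder α} := by
  apply le_antisymm
  · refine iSup_le fun k => ?_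
    rintro _ ⟨B, -, rfl⟩
    have h : (fun x : ℕ → S => x k) ⁻¹' B =
        ⋃ α : {α : Fin (k + 1) → S // α (Fin.last k) ∈ B}, _root_.cylinder α.1 := by
      ext x
      simp only [Set.mem_preimage, Set.mem_iUnion, Subtype.exists]
      constructor
      · exact fun hx => ⟨fun i => x i, hx, fun _ => rfl⟩
      · rintro ⟨α, hα, hx⟩
        have := hx (Fin.last k)
        simp only [Fin.val_last] at this
        rwa [this]
    rw [h]
    exact MeasurableSet.iUnion fun α => MeasurableSpace.measurableSet_generateFrom ⟨_, _, rfl⟩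
  · apply MeasurableSpace.generateFrom_le
    rintro _ ⟨n, α, rfl⟩
    exact measurableSet_word_cylinder α

theorem ext_of_word_cylinders {S : Type*} [Finite S] [MeasurableSpace S]
    [DiscreteMeasurableSpace S] {μ ν : Measure (ℕ → S)} [IsFiniteMeasure μ]
    (h : ∀ (n : ℕ) (α : Fin n → S), μ (_root_.cylinder α) = ν (_root_.cylinder α)) : μ = ν := by
  refine ext_of_generate_finite _ generateFrom_word_cylinders isPiSystem_word_cylinders ?_ ?_
  · rintro _ ⟨n, α, rfl⟩
    exact h n α
  · have hu : _root_.cylinder (Fin.elim0 : Fin 0 → S) = Set.univ := by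
      ext x
      simp [_root_.cylinder]
    rw [← hu, h]

/-- The extension of a word to a sequence that is constantly `s₀` past the end of the word. -/
def padWord {S : Type*} (s₀ : S) {n : ℕ} (α : Fin n → S) (k : ℕ) : S :=
  if h : k < n then α ⟨k, h⟩ else s₀

theorem padWord_mem_cylinder_iff {S : Type*} (s₀ : S) {n : ℕ} (α β : Fin n → S) :
    padWord s₀ β ∈ _root_.cylinder α ↔ β = α := by
  simp [_root_.cylinder, padWord, funext_iff]

theorem padWord_snoc_mem_cylinder_iff {S : Type*} (s₀ : S) {n N : ℕ} (hN : n ≤ N)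
    (α : Fin n → S) (β : Fin N → S) (s : S) :
    padWord s₀ (Fin.snoc β s : Fin (N + 1) → S) ∈ _root_.cylinder α ↔
      padWord s₀ β ∈ _root_.cylinder α := by
  refine forall_congr' fun i => ?_
  have hi : (i : ℕ) < N := i.2.trans_le hN
  simp [padWord, Fin.snoc, hi, hi.trans (Nat.lt_succ_self N)]

/-- The finitely supported measure giving mass `w N α` to the padding of each word `α` of
length `N`. -/
noncomputable def wordMeasure {S : Type*} [Fintype S] [MeasurableSpace S] (s₀ : S)
    (w : ∀ n, (Fin n → S) → ENNReal) (N : ℕ) : Measure (ℕ → S) :=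
  ∑ β : Fin N → S, w N β • Measure.dirac (padWord s₀ β)

theorem wordMeasure_cylinder {S : Type*} [Fintype S] [MeasurableSpace S]
    [DiscreteMeasurableSpace S] (s₀ : S) (w : ∀ n, (Fin n → S) → ENNReal)
    (hw : ∀ n (α : Fin n → S), ∑ s, w (n + 1) (Fin.snoc α s) = w n α)
    {n N : ℕ} (hN : n ≤ N) (α : Fin n → S) :
    wordMeasure s₀ w N (_root_.cylinder α) = w n α := by
  classical
  have key (N : ℕ) : wordMeasure s₀ w N (_root_.cylinder α) =
      ∑ β : Fin N → S, if padWord s₀ β ∈ _root_.cylinder α then w N β else 0 := by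
    simp [wordMeasure, Measure.dirac_apply' _ (measurableSet_word_cylinder α), Set.indicator_apply]
  induction N, hN using Nat.le_induction with
  | base => simp [key, padWord_mem_cylinder_iff]
  | succ N hN ih =>
    rw [← ih, key, key, ← (Fin.snocEquiv fun _ : Fin (N + 1) => S).sum_comp,
      Fintype.sum_prod_type_right]
    refine Finset.sum_congr rfl fun β _ => ?_
    simp only [Fin.snocEquiv, Equiv.coe_fn_mk, padWord_snoc_mem_cylinder_iff s₀ hN]
    split_ifs
    · exact hw N β
    · simp

/-- A consistent family of weights on finite words over a finite alphabet is given by the values on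
cylinders of a probability measure on infinite words. -/
theorem exists_measure_word_cylinder {S : Type*} [Fintype S] [Nonempty S] [MeasurableSpace S]
    [DiscreteMeasurableSpace S] (w : ∀ n, (Fin n → S) → ENNReal)
    (hw₀ : ∀ α : Fin 0 → S, w 0 α = 1)
    (hw : ∀ n (α : Fin n → S), ∑ s, w (n + 1) (Fin.snoc α s) = w n α) :
    ∃ ν : Measure (ℕ → S), IsProbabilityMeasure ν ∧
      ∀ (n : ℕ) (α : Fin n → S), ν (_root_.cylinder α) = w n α := by
  obtain ⟨s₀⟩ := ‹Nonempty S›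
  let _ : TopologicalSpace S := ⊥
  have _ : DiscreteTopology S := ⟨rfl⟩
  let _ : MetricSpace (ℕ → S) := TopologicalSpace.metrizableSpaceMetric _
  have hprob (N : ℕ) : IsProbabilityMeasure (wordMeasure s₀ w N) := by
    refine ⟨?_⟩
    have hu : _root_.cylinder (Fin.elim0 : Fin 0 → S) = Set.univ := by
      ext x
      simp [_root_.cylinder]
    rw [← hu, wordMeasure_cylinder s₀ w hw (Nat.zero_le N), hw₀]
  let P (N : ℕ) : ProbabilityMeasure (ℕ → S) := ⟨wordMeasure s₀ w N, hprob N⟩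
  let F : Ultrafilter ℕ := Ultrafilter.of Filter.atTop
  have hF : (F : Filter ℕ) ≤ Filter.atTop := Ultrafilter.of_le _
  obtain ⟨ν, -, hν⟩ := (isCompact_univ (X := ProbabilityMeasure (ℕ → S))).ultrafilter_le_nhds
    (F.map P) (by simp)
  have hlim : Filter.Tendsto P F (nhds ν) := hν
  refine ⟨ν, inferInstance, fun n α => ?_⟩
  have hclopen : IsClopen (_root_.cylinder α) := by
    have h : _root_.cylinder α = ⋂ i : Fin n, (fun x : ℕ → S => x i) ⁻¹' {α i} := by
      ext x
      simp [_root_.cylinder]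
    rw [h]
    exact isClopen_iInter_of_finite fun i =>
      (isClopen_discrete _).preimage (continuous_apply (i : ℕ))
  have h₁ := ProbabilityMeasure.tendsto_measure_of_null_frontier_of_tendsto' hlim
    (E := _root_.cylinder α) (by simp [hclopen.frontier_eq])
  refine tendsto_nhds_unique h₁ (tendsto_const_nhds.congr' ?_)
  filter_upwards [hF (Filter.eventually_ge_atTop n)] with N hN
  exact (wordMeasure_cylinder s₀ w hw hN α).symm

theorem wordMap_snoc {S d : Type*} [Fintype d] [DecidableEq d] (A : S → Matrix d d ℂ) {n : ℕ}
    (α : Fin n → S) (s : S) :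
    wordMap A (Fin.snoc α s : Fin (n + 1) → S) = wordMap A α * A s := by
  rw [wordMap, List.ofFn_succ', List.concat_eq_append, List.prod_append]
  simp only [Fin.snoc_castSucc, Fin.snoc_last, List.prod_singleton, wordMap]

theorem wordMap_cons {S d : Type*} [Fintype d] [DecidableEq d] (A : S → Matrix d d ℂ) {n : ℕ}
    (α : Fin n → S) (s : S) :
    wordMap A (Fin.cons s α : Fin (n + 1) → S) = A s * wordMap A α := by
  simp [wordMap, List.ofFn_succ]

/-- A probability measure on sequences over a finite alphabet is shift-invariant as soon as
prefixing a word by a letter in all possible ways preserves the total mass of its cylinder. -/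
theorem measurePreserving_shift_of_cylinder {S : Type*} [Fintype S] [MeasurableSpace S]
    [DiscreteMeasurableSpace S] (ν : Measure (ℕ → S)) [IsFiniteMeasure ν]
    (h : ∀ (n : ℕ) (α : Fin n → S),
      ∑ s, ν (_root_.cylinder (Fin.cons s α : Fin (n + 1) → S)) = ν (_root_.cylinder α)) :
    MeasurePreserving (fun (x : ℕ → S) (n : ℕ) => x (n + 1)) ν ν := by
  have hm : Measurable fun (x : ℕ → S) (n : ℕ) => x (n + 1) :=
    measurable_pi_lambda _ fun n => measurable_pi_apply (n + 1)
  refine ⟨hm, ext_of_word_cylinders fun n α => ?_⟩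
  have hpre : (fun (x : ℕ → S) (n : ℕ) => x (n + 1)) ⁻¹' _root_.cylinder α =
      ⋃ s, _root_.cylinder (Fin.cons s α : Fin (n + 1) → S) := by
    ext x
    simp [_root_.cylinder, Fin.forall_fin_succ]
  rw [Measure.map_apply hm (measurableSet_word_cylinder α), hpre, measure_iUnion, tsum_fintype, h]
  · intro s t hst
    refine Set.disjoint_left.2 fun x hs ht => hst ?_
    exact (hs 0).symm.trans (ht 0)
  · exact fun s => measurableSet_word_cylinder _

/-- There exists a probability measure `ν` on the product σ-algebra of
`X = S^{ℤ₊}` such that `ν([α]) = Tr(A(α)* E A(α))` for every word `α`, and `ν` is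
invariant under the left shift. -/
theorem kusuoka_measure_exists
    {S : Type*} [Fintype S] [Nonempty S] [MeasurableSpace S] [DiscreteMeasurableSpace S]
    {d : Type*} [Fintype d] [DecidableEq d]
    (A : S → Matrix d d ℂ) (E : Matrix d d ℂ)
    (hE : E.PosDef) (hTrE : E.trace = 1)
    (hfund1 : ∑ s : S, (A s)ᴴ * E * A s = E)
    (hfund2 : ∑ s : S, A s * (A s)ᴴ = 1) :
    ∃ ν : Measure (ℕ → S), IsProbabilityMeasure ν ∧
      (∀ (n : ℕ) (α : Fin n → S),
        ν (cylinder α) =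
          ENNReal.ofReal (((wordMap A α)ᴴ * E * wordMap A α).trace.re)) ∧
      MeasurePreserving (fun (x : ℕ → S) (n : ℕ) => x (n + 1)) ν ν := by
  have hnonneg (B : Matrix d d ℂ) : 0 ≤ (Bᴴ * E * B).trace.re :=
    (Complex.le_def.1 (hE.posSemidef.conjTranspose_mul_mul_same B).trace_nonneg).1
  have hsum (f : S → Matrix d d ℂ) (B : Matrix d d ℂ)
      (hf : ∑ s, ((f s)ᴴ * E * f s).trace = (Bᴴ * E * B).trace) :
      ∑ s, ENNReal.ofReal ((f s)ᴴ * E * f s).trace.re =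
        ENNReal.ofReal (Bᴴ * E * B).trace.re := by
    rw [← ENNReal.ofReal_sum_of_nonneg fun s _ => hnonneg (f s), ← Complex.re_sum, hf]
  obtain ⟨ν, hν, hcyl⟩ := exists_measure_word_cylinder
    (fun n (α : Fin n → S) => ENNReal.ofReal ((wordMap A α)ᴴ * E * wordMap A α).trace.re)
    (fun α => by simp [wordMap, hTrE])
    (fun n α => by
      refine hsum _ _ ?_
      have h (s : S) : ((wordMap A (Fin.snoc α s : Fin (n + 1) → S))ᴴ * E *
          wordMap A (Fin.snoc α s : Fin (n + 1) → S)).trace =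
          ((wordMap A α)ᴴ * E * wordMap A α * (A s * (A s)ᴴ)).trace := by
        rw [wordMap_snoc, conjTranspose_mul, ← Matrix.mul_assoc _ (A s), trace_mul_comm _ (A s)ᴴ]
        simp only [Matrix.mul_assoc]
      simp only [h]
      rw [← trace_sum, ← Matrix.mul_sum, hfund2, Matrix.mul_one])
  refine ⟨ν, hν, hcyl, measurePreserving_shift_of_cylinder ν fun n α => ?_⟩
  simp only [hcyl]
  refine hsum _ _ ?_
  have h (s : S) : ((wordMap A (Fin.cons s α : Fin (n + 1) → S))ᴴ * E *
      wordMap A (Fin.cons s α : Fin (n + 1) → S)).trace =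
      ((wordMap A α)ᴴ * ((A s)ᴴ * E * A s) * wordMap A α).trace := by
    rw [wordMap_cons, conjTranspose_mul]
    simp only [Matrix.mul_assoc]
  simp only [h]
  rw [← trace_sum, ← Matrix.sum_mul, ← Matrix.mul_sum, hfund1]
end

section
/- Suppose ∑_{s∈S} A_s A_s* = I and the system is irreducible. If P is an orthogonal projection on H satisfying ∑_{s∈S} A_s P A_s* = P, then P = 0 or P = I. -/
open MeasureTheory Matrix
open scoped ComplexOrder

/-- The system `{A_s}` is irreducible: no nontrivial common invariant subspace. -/
def Irreducible' {S : Type*} {d : Type*} [Fintype d] [DecidableEq d]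
    (A : S → Matrix d d ℂ) : Prop :=
  ∀ W : Submodule ℂ (d → ℂ), (∀ s : S, ∀ x ∈ W, (A s).mulVec x ∈ W) → W = ⊥ ∨ W = ⊤

/-- If `∑ M_s M_sᴴ = 0`, then every `M_s` vanishes. -/
theorem eq_zero_of_sum_mul_conjTranspose_eq_zero {S m n : Type*} [Fintype S] [Fintype m] [Fintype n]
    (M : S → Matrix m n ℂ) (h : ∑ s, M s * (M s)ᴴ = 0) (s : S) : M s = 0 := by
  have htr : ∑ s, (M s * (M s)ᴴ).trace = 0 := by rw [← trace_sum, h, trace_zero]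
  rw [Finset.sum_eq_zero_iff_of_nonneg
    fun s _ => (posSemidef_self_mul_conjTranspose (M s)).trace_nonneg] at htr
  exact trace_mul_conjTranspose_self_eq_zero_iff.mp (htr s (Finset.mem_univ s))

/-- The range of a projection fixed by `X ↦ ∑ A_s X A_sᴴ` is invariant under every `A_s`. -/
theorem mul_mul_eq_of_sum_mul_mul_conjTranspose_eq {S d : Type*} [Fintype S] [Fintype d]
    [DecidableEq d] (A : S → Matrix d d ℂ) (P : Matrix d d ℂ) (hP : P.IsHermitian)
    (hidem : P * P = P) (hfix : ∑ s, A s * P * (A s)ᴴ = P) (s : S) :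
    P * (A s * P) = A s * P := by
  have hzero : (1 - P) * A s * P = 0 := by
    refine eq_zero_of_sum_mul_conjTranspose_eq_zero (fun s => (1 - P) * A s * P) ?_ s
    calc ∑ s, (1 - P) * A s * P * ((1 - P) * A s * P)ᴴ
        = ∑ s, (1 - P) * (A s * P * (A s)ᴴ) * (1 - P) := by
          refine Finset.sum_congr rfl fun s _ => ?_
          rw [conjTranspose_mul, conjTranspose_mul, conjTranspose_sub, conjTranspose_one, hP.eq]
          simp only [Matrix.mul_assoc]
          rw [← Matrix.mul_assoc P P, hidem]
      _ = (1 - P) * P * (1 - P) := by rw [← Finset.sum_mul, ← Finset.mul_sum, hfix]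
      _ = 0 := by rw [Matrix.sub_mul, Matrix.one_mul, hidem, sub_self, Matrix.zero_mul]
  rw [Matrix.mul_assoc, Matrix.sub_mul, Matrix.one_mul, sub_eq_zero] at hzero
  exact hzero.symm

/-- if `∑_s A_s A_s* = I`, the system is irreducible and `P` is an
orthogonal projection with `∑_s A_s P A_s* = P`, then `P = 0` or `P = I`. -/
theorem invariant_projection_trivial
    {S : Type*} [Fintype S] [Nonempty S]
    {d : Type*} [Fintype d] [DecidableEq d]
    (A : S → Matrix d d ℂ)
    (hfund2 : ∑ s : S, A s * (A s)ᴴ = 1)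
    (hirr : Irreducible' A)
    (P : Matrix d d ℂ) (hPsa : P.IsHermitian) (hPidem : P * P = P)
    (hPfix : ∑ s : S, A s * P * (A s)ᴴ = P) :
    P = 0 ∨ P = 1 := by
  have hinv := mul_mul_eq_of_sum_mul_mul_conjTranspose_eq A P hPsa hPidem hPfix
  rcases hirr (LinearMap.range P.mulVecLin) (by
    rintro s _ ⟨v, rfl⟩
    exact ⟨(A s * P) *ᵥ v, by simp [hinv s]⟩) with h | h
  · left
    rw [LinearMap.range_eq_bot] at h
    exact ext_of_mulVec_single fun i => by
      rw [zero_mulVec]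
      exact LinearMap.congr_fun h (Pi.single i 1)
  · right
    have hunit : IsUnit P :=
      mulVec_surjective_iff_isUnit.mp (LinearMap.range_eq_top.mp h)
    exact hunit.mul_left_cancel (by rw [hPidem, Matrix.mul_one])
end

section
/- The Sierpiński gasket matrices A_s = R^{−s} D R^{s}, s ∈ {0,1,2}, are symmetric and satisfy the two fundamental equations ∑_{s=0}^{2} A_s A_s^T = I and ∑_{s=0}^{2} A_s^T E A_s = E with E = (1/2)I; equivalently, ∑_{s=0}^{2} A_s² = I. -/
open Matrix

/-- Rotation of the plane by the angle `2π/3`. -/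
noncomputable def sgRot : Matrix (Fin 2) (Fin 2) ℝ :=
  !![Real.cos (2 * Real.pi / 3), -Real.sin (2 * Real.pi / 3);
     Real.sin (2 * Real.pi / 3),  Real.cos (2 * Real.pi / 3)]

/-- The diagonal matrix `D = diag(3/√15, 1/√15)`. -/
noncomputable def sgD : Matrix (Fin 2) (Fin 2) ℝ :=
  !![3 / Real.sqrt 15, 0; 0, 1 / Real.sqrt 15]

/-- The Sierpiński gasket restriction maps `A_s = R^{-s} D R^{s}`, `s ∈ {0,1,2}`. -/
noncomputable def sgA (s : Fin 3) : Matrix (Fin 2) (Fin 2) ℝ :=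
  (sgRot ^ (s : ℕ))⁻¹ * sgD * sgRot ^ (s : ℕ)

lemma sgRot_eq : sgRot = !![-1 / 2, -(√3 / 2); √3 / 2, -1 / 2] := by
  have h : 2 * Real.pi / 3 = Real.pi - Real.pi / 3 := by ring
  rw [sgRot, h, Real.cos_pi_sub, Real.sin_pi_sub, Real.cos_pi_div_three,
    Real.sin_pi_div_three, neg_div]

lemma sgRot_transpose_mul : sgRotᵀ * sgRot = 1 := by
  have h : √3 * √3 = (3 : ℝ) := Real.mul_self_sqrt (by norm_num)
  rw [sgRot_eq]
  ext i j
  fin_cases i <;> fin_cases j <;> simp [Matrix.mul_apply] <;> linarith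

lemma sgRot_pow_inv (n : ℕ) : (sgRot ^ n)⁻¹ = (sgRot ^ n)ᵀ := by
  rw [← Matrix.inv_pow', Matrix.inv_eq_left_inv sgRot_transpose_mul, Matrix.transpose_pow]

lemma sgA_transpose (s : Fin 3) : (sgA s)ᵀ = sgA s := by
  have hD : sgDᵀ = sgD := by
    ext i j
    fin_cases i <;> fin_cases j <;> simp [sgD]
  simp only [sgA, sgRot_pow_inv, Matrix.transpose_mul, Matrix.transpose_transpose, hD,
    Matrix.mul_assoc]

lemma sgD_mul_self : sgD * sgD = !![3 / 5, 0; 0, 1 / 15] := by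
  have h : √15 * √15 = (15 : ℝ) := Real.mul_self_sqrt (by norm_num)
  ext i j
  fin_cases i <;> fin_cases j <;>
    simp [sgD, Matrix.mul_apply, div_mul_div_comm, ← mul_inv, h]
  norm_num

lemma sgA_mul_self (s : Fin 3) :
    sgA s * sgA s = (sgRotᵀ) ^ (s : ℕ) * !![3 / 5, 0; 0, 1 / 15] * sgRot ^ (s : ℕ) := by
  have h : sgRot ^ (s : ℕ) * (sgRotᵀ) ^ (s : ℕ) = 1 := by
    rw [← Matrix.transpose_pow, ← sgRot_pow_inv]
    refine Matrix.mul_nonsing_inv _ ?_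
    rw [Matrix.det_pow]
    exact (Matrix.isUnit_det_of_left_inverse sgRot_transpose_mul).pow _
  rw [← sgD_mul_self, sgA, sgRot_pow_inv, Matrix.transpose_pow]
  calc _ = (sgRotᵀ) ^ (s : ℕ) * sgD * (sgRot ^ (s : ℕ) * (sgRotᵀ) ^ (s : ℕ)) * sgD *
        sgRot ^ (s : ℕ) := by simp only [Matrix.mul_assoc]
    _ = _ := by rw [h, Matrix.mul_one, Matrix.mul_assoc _ sgD sgD]

lemma sum_sgA_mul_self : ∑ s : Fin 3, sgA s * sgA s = 1 := by
  have h : √3 ^ 2 = (3 : ℝ) := Real.sq_sqrt (by norm_num)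
  have h3 : √3 ^ 3 = 3 * √3 := by rw [pow_succ, h]
  have h4 : √3 ^ 4 = (9 : ℝ) := by rw [show 4 = 2 * 2 from rfl, pow_mul, h]; norm_num
  simp only [sgA_mul_self, Fin.sum_univ_three, sgRot_eq]
  ext i j
  fin_cases i <;> fin_cases j <;>
    simp [Matrix.mul_apply, pow_two, Fin.sum_univ_two] <;> ring_nf <;> linarith

/-- the Sierpiński gasket matrices are symmetric and satisfy the two
fundamental equations `∑ A_s A_sᵀ = I` and `∑ A_sᵀ E A_s = E` with `E = (1/2)I`;
equivalently `∑ A_s² = I`. -/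
theorem sg_fundamental_equations :
    (∀ s : Fin 3, (sgA s)ᵀ = sgA s) ∧
    (∑ s : Fin 3, sgA s * (sgA s)ᵀ = 1) ∧
    (∑ s : Fin 3, (sgA s)ᵀ * ((1 / 2 : ℝ) • (1 : Matrix (Fin 2) (Fin 2) ℝ)) * sgA s =
      (1 / 2 : ℝ) • (1 : Matrix (Fin 2) (Fin 2) ℝ)) ∧
    (∑ s : Fin 3, sgA s * sgA s = 1) := by
  refine ⟨sgA_transpose, ?_, ?_, sum_sgA_mul_self⟩
  · simpa only [sgA_transpose] using sum_sgA_mul_self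
  · simp only [sgA_transpose, Matrix.mul_smul, Matrix.smul_mul, Matrix.mul_one,
      ← Finset.smul_sum, sum_sgA_mul_self]
end

section
/- For ν-almost every x ∈ X, one has ν([x]_n) > 0 for all n and the limit g(x) := lim_{n→∞} ν([x]_n) / ν([Tx]_{n−1}) exists and lies in [0,1], where [x]_n is the cylinder of length n containing x. -/
open MeasureTheory Matrix Filter
open scoped ComplexOrder ENNReal Topology

/-- The left shift `(Tx)(n) = x(n+1)`. -/
def shift {S : Type*} : (ℕ → S) → ℕ → S := fun x n => x (n + 1)

/-- The word `[x]_n = (x(0),…,x(n−1))`. -/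
def initWord {S : Type*} (x : ℕ → S) (n : ℕ) : Fin n → S := fun i => x (i : ℕ)

/-- On a non-null fibre of `f`, the conditional probability of `t` given `f` is the elementary
conditional probability. -/
theorem condExp_comap_indicator_apply {Ω β : Type*} [mΩ : MeasurableSpace Ω]
    [mβ : MeasurableSpace β] [MeasurableSingletonClass β] (μ : Measure Ω) [IsFiniteMeasure μ]
    {f : Ω → β} (hf : Measurable f) {t : Set Ω} (ht : MeasurableSet t) {x : Ω}
    (hx : μ (f ⁻¹' {f x}) ≠ 0) :
    (μ[t.indicator (fun _ => (1 : ℝ)) | mβ.comap f]) x =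
      μ.real (t ∩ f ⁻¹' {f x}) / μ.real (f ⁻¹' {f x}) := by
  set B := f ⁻¹' {f x}
  have hB : MeasurableSet[mβ.comap f] B := ⟨{f x}, measurableSet_singleton _, rfl⟩
  have hBΩ : MeasurableSet B := hf.comap_le _ hB
  have hconst : ∀ y ∈ B, (μ[t.indicator (fun _ => (1 : ℝ)) | mβ.comap f]) y =
      (μ[t.indicator (fun _ => (1 : ℝ)) | mβ.comap f]) x := by
    obtain ⟨h, -, hh⟩ := (stronglyMeasurable_condExp (μ := μ) (m := mβ.comap f)
      (f := t.indicator (fun _ => (1 : ℝ)))).measurable.exists_eq_measurable_comp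
    intro y hy
    rw [hh, Function.comp_apply, Function.comp_apply, show f y = f x from hy]
  have hint : Integrable (t.indicator (fun _ => (1 : ℝ))) μ := (integrable_const 1).indicator ht
  have key := setIntegral_condExp hf.comap_le hint hB
  rw [setIntegral_congr_fun hBΩ hconst, setIntegral_const, setIntegral_indicator ht,
    setIntegral_const, smul_eq_mul, smul_eq_mul, mul_one, Set.inter_comm] at key
  have hpos : μ.real B ≠ 0 := (measureReal_ne_zero_iff).2 hx
  rw [← key]
  field_simp

theorem measurable_initWord {S : Type*} [MeasurableSpace S] (n : ℕ) :
    Measurable fun x : ℕ → S => initWord x n :=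
  measurable_pi_lambda _ fun i => measurable_pi_apply (i : ℕ)

theorem measurable_shift {S : Type*} [MeasurableSpace S] :
    Measurable (shift : (ℕ → S) → ℕ → S) :=
  measurable_pi_lambda _ fun n => measurable_pi_apply (n + 1)

theorem cylinder_eq_preimage_initWord {S : Type*} {n : ℕ} (α : Fin n → S) :
    _root_.cylinder α = (fun x => initWord x n) ⁻¹' {α} := by
  ext x
  simp [_root_.cylinder, initWord, funext_iff]

theorem measurableSet_cylinder_word {S : Type*} [MeasurableSpace S] [MeasurableSingletonClass S]
    {n : ℕ} (α : Fin n → S) : MeasurableSet (_root_.cylinder α) := by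
  rw [cylinder_eq_preimage_initWord]
  exact measurable_initWord n (measurableSet_singleton α)

theorem cylinder_initWord_succ {S : Type*} (x : ℕ → S) (n : ℕ) :
    _root_.cylinder (initWord x (n + 1)) =
      (fun y => y 0) ⁻¹' {x 0} ∩ shift ⁻¹' _root_.cylinder (initWord (shift x) n) := by
  ext y
  simp [_root_.cylinder, initWord, shift, Fin.forall_fin_succ]

/-- Almost every point has only cylinders of positive measure. -/
theorem ae_forall_cylinder_pos {S : Type*} [Countable S] [MeasurableSpace S]
    (ν : Measure (ℕ → S)) :
    ∀ᵐ x ∂ν, ∀ n : ℕ, 0 < ν (_root_.cylinder (initWord x n)) := by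
  rw [ae_all_iff]
  intro n
  have h : ∀ᵐ x ∂ν, ∀ α : Fin n → S, ν (_root_.cylinder α) = 0 → x ∉ _root_.cylinder α := by
    rw [ae_all_iff]
    intro α
    by_cases hα : ν (_root_.cylinder α) = 0
    · filter_upwards [measure_eq_zero_iff_ae_notMem.1 hα] with x hx _ using hx
    · exact Eventually.of_forall fun x h => absurd h hα
  filter_upwards [h] with x hx
  exact pos_iff_ne_zero.2 fun h0 => hx _ h0 fun _ => rfl

/-- The filtration whose `n`-th term is generated by the coordinates `1, …, n`. -/
def shiftedWordFiltration (S : Type*) [MeasurableSpace S] :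
    Filtration ℕ (inferInstance : MeasurableSpace (ℕ → S)) where
  seq n := MeasurableSpace.comap (fun x => initWord (shift x) n) inferInstance
  mono' := by
    intro m n hmn
    have hr : Measurable fun (w : Fin n → S) (i : Fin m) => w (Fin.castLE hmn i) :=
      measurable_pi_lambda _ fun i => measurable_pi_apply _
    rintro _ ⟨u, hu, rfl⟩
    exact ⟨_, hr hu, rfl⟩
  le' n := ((measurable_initWord n).comp measurable_shift).comap_le

/-- For a shift-invariant measure, the ratios `ν([x]_{n+1}) / ν([Tx]_n)` converge almost
everywhere, by Lévy's upward theorem. -/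
theorem ae_exists_tendsto_cylinder_ratio {S : Type*} [Countable S] [MeasurableSpace S]
    [MeasurableSingletonClass S] (ν : Measure (ℕ → S)) [IsFiniteMeasure ν]
    (hshift : MeasurePreserving (shift : (ℕ → S) → ℕ → S) ν ν) :
    ∀ᵐ x ∂ν, ∃ l : ℝ, Tendsto (fun n : ℕ =>
      (ν (_root_.cylinder (initWord x (n + 1)))).toReal /
        (ν (_root_.cylinder (initWord (shift x) n))).toReal) atTop (𝓝 l) := by
  have hlim : ∀ᵐ x ∂ν, ∀ s : S, Tendsto (fun n =>
      (ν[((fun y : ℕ → S => y 0) ⁻¹' {s}).indicator (fun _ => (1 : ℝ)) | shiftedWordFiltration S n]) x)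
      atTop (𝓝 ((ν[((fun y : ℕ → S => y 0) ⁻¹' {s}).indicator (fun _ => (1 : ℝ)) |
        ⨆ n, shiftedWordFiltration S n]) x)) :=
    ae_all_iff.2 fun s => tendsto_ae_condExp _
  filter_upwards [hlim, hshift.quasiMeasurePreserving.ae (ae_forall_cylinder_pos ν)]
    with x hx hpos
  refine ⟨_, (hx (x 0)).congr fun n => ?_⟩
  have hfib : (fun y => initWord (shift y) n) ⁻¹' {initWord (shift x) n} =
      shift ⁻¹' _root_.cylinder (initWord (shift x) n) := by
    rw [cylinder_eq_preimage_initWord]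
    rfl
  have hmeas : ν (shift ⁻¹' _root_.cylinder (initWord (shift x) n)) =
      ν (_root_.cylinder (initWord (shift x) n)) :=
    hshift.measure_preimage (measurableSet_cylinder_word _).nullMeasurableSet
  have hzero : MeasurableSet ((fun y : ℕ → S => y 0) ⁻¹' {x 0}) :=
    measurable_pi_apply 0 (measurableSet_singleton (x 0))
  have hval := condExp_comap_indicator_apply ν ((measurable_initWord n).comp measurable_shift) hzero
    (x := x) (by
      change ν ((fun y => initWord (shift y) n) ⁻¹' {initWord (shift x) n}) ≠ 0
      rw [hfib, hmeas]
      exact (hpos n).ne')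
  refine hval.trans ?_
  change ν.real (_ ∩ (fun y => initWord (shift y) n) ⁻¹' {initWord (shift x) n}) /
    ν.real ((fun y => initWord (shift y) n) ⁻¹' {initWord (shift x) n}) = _
  rw [hfib, ← cylinder_initWord_succ, Measure.real, Measure.real, hmeas]

/-- for ν-almost every `x`, `ν([x]_n) > 0` for all `n` and the limit
`g(x) = lim_n ν([x]_n)/ν([Tx]_{n−1})` exists and lies in `[0,1]`. -/
theorem g_function_exists
    {S : Type*} [Fintype S] [Nonempty S] [MeasurableSpace S] [DiscreteMeasurableSpace S]
    {d : Type*} [Fintype d] [DecidableEq d]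
    (A : S → Matrix d d ℂ) (E : Matrix d d ℂ)
    (hE : E.PosDef) (hTrE : E.trace = 1)
    (hfund1 : ∑ s : S, (A s)ᴴ * E * A s = E)
    (hfund2 : ∑ s : S, A s * (A s)ᴴ = 1)
    (ν : Measure (ℕ → S)) [IsProbabilityMeasure ν]
    (hν : ∀ (n : ℕ) (α : Fin n → S),
      ν (cylinder α) = ENNReal.ofReal (((wordMap A α)ᴴ * E * wordMap A α).trace.re))
    (hshift : MeasurePreserving (shift : (ℕ → S) → ℕ → S) ν ν) :
    ∀ᵐ x ∂ν, (∀ n : ℕ, 0 < ν (cylinder (initWord x n))) ∧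
      ∃ l ∈ Set.Icc (0 : ℝ) 1,
        Tendsto (fun n : ℕ =>
            (ν (cylinder (initWord x (n + 1)))).toReal /
              (ν (cylinder (initWord (shift x) n))).toReal)
          atTop (𝓝 l) := by
  filter_upwards [ae_forall_cylinder_pos ν, ae_exists_tendsto_cylinder_ratio ν hshift]
    with x hpos ⟨l, hl⟩
  refine ⟨hpos, l, isClosed_Icc.mem_of_tendsto hl (Eventually.of_forall fun n => ?_), hl⟩
  refine ⟨by positivity, div_le_one_of_le₀ (ENNReal.toReal_mono (measure_ne_top _ _) ?_)
    ENNReal.toReal_nonneg⟩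
  rw [cylinder_initWord_succ, ← hshift.measure_preimage
    (measurableSet_cylinder_word (initWord (shift x) n)).nullMeasurableSet]
  exact measure_mono Set.inter_subset_right
end
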